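/- For all a < b, μ > 0 and R > 0 there exist T₀ > 0 and C > 0, depending only on a, b, μ and R, with the following property: for every T > 0, every ν ≥ 0, and every smooth solution (u, θ) of the regularized thermoelasticity system on [0,T] with θ ≥ 0 whose initial data satisfy ‖u₁‖_{L²} ≤ R, ‖(u₀)_x‖_{L²} ≤ R, ‖θ₀‖_{L²} ≤ R, ∫_a^b θ₀ ≤ R, ‖u_tt(0)‖_{L²} ≤ R, ‖u_tx(0)‖_{L²} ≤ R and ‖θ_t(0)‖_{L²} ≤ R, one has for every t ∈ [0, min(T, T₀)]: ‖u_tt(t)‖_{L²}² + ‖u_tx(t)‖_{L²}² + ‖θ_t(t)‖_{L²}² + ∫₀ᵗ ‖θ_tx(s)‖_{L²}² ds ≤ C ( ‖u_tt(0)‖_{L²} + ‖u_tx(0)‖_{L²} + ‖θ_t(0)‖_{L²} )². -/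

import Mathlib

open Set MeasureTheory

/-- Partial derivative in the first (time) variable. -/
noncomputable def pt (w : ℝ → ℝ → ℝ) (t x : ℝ) : ℝ := deriv (fun s => w s x) t

/-- Partial derivative in the second (space) variable. -/
noncomputable def px (w : ℝ → ℝ → ℝ) (t x : ℝ) : ℝ := deriv (fun y => w t y) x

/-- Square of the L² norm on (a,b). -/
noncomputable def sqInt (a b : ℝ) (f : ℝ → ℝ) : ℝ := ∫ x in a..b, (f x) ^ 2

/-- The L² norm on (a,b). -/
noncomputable def L2norm (a b : ℝ) (f : ℝ → ℝ) : ℝ := Real.sqrt (sqInt a b f)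

/-- A smooth solution of the regularized thermoelasticity system on [0,T] × [a,b]:
`u_tt − u_xx − ν u_txx = −μ θ_x`, `θ_t − θ_xx + μ θ u_tx = 0`,
with Dirichlet boundary conditions for `u` and Neumann boundary conditions for `θ`. -/
def IsRegSolution (a b μ T ν : ℝ) (u θ : ℝ → ℝ → ℝ) : Prop :=
  ContDiff ℝ (⊤ : ℕ∞) (Function.uncurry u) ∧ ContDiff ℝ (⊤ : ℕ∞) (Function.uncurry θ) ∧
  (∀ t ∈ Set.Icc (0:ℝ) T, ∀ x ∈ Set.Icc a b,
      pt (pt u) t x - px (px u) t x - ν * px (px (pt u)) t x = -μ * px θ t x) ∧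
  (∀ t ∈ Set.Icc (0:ℝ) T, ∀ x ∈ Set.Icc a b,
      pt θ t x - px (px θ) t x + μ * θ t x * px (pt u) t x = 0) ∧
  (∀ t ∈ Set.Icc (0:ℝ) T, u t a = 0 ∧ u t b = 0) ∧
  (∀ t ∈ Set.Icc (0:ℝ) T, px θ t a = 0 ∧ px θ t b = 0)

open scoped ContDiff

section PartialDerivatives

variable {w : ℝ → ℝ → ℝ}

lemma hasDerivAt_fst_fderiv (hw : ContDiff ℝ ∞ (Function.uncurry w)) (t x : ℝ) :
    HasDerivAt (fun s => w s x) (fderiv ℝ (Function.uncurry w) (t, x) (1, 0)) t :=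
  HasFDerivAt.comp_hasDerivAt (f := fun s : ℝ => (s, x)) t
    ((hw.differentiable (by simp)) (t, x)).hasFDerivAt ((hasDerivAt_id t).prodMk (hasDerivAt_const t x))

lemma hasDerivAt_snd_fderiv (hw : ContDiff ℝ ∞ (Function.uncurry w)) (t x : ℝ) :
    HasDerivAt (fun y => w t y) (fderiv ℝ (Function.uncurry w) (t, x) (0, 1)) x :=
  HasFDerivAt.comp_hasDerivAt (f := fun y : ℝ => (t, y)) x
    ((hw.differentiable (by simp)) (t, x)).hasFDerivAt ((hasDerivAt_const x t).prodMk (hasDerivAt_id x))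

lemma uncurry_pt_eq_fderiv (hw : ContDiff ℝ ∞ (Function.uncurry w)) :
    Function.uncurry (pt w) = fun z => fderiv ℝ (Function.uncurry w) z (1, 0) :=
  funext fun z => (hasDerivAt_fst_fderiv hw z.1 z.2).deriv

lemma uncurry_px_eq_fderiv (hw : ContDiff ℝ ∞ (Function.uncurry w)) :
    Function.uncurry (px w) = fun z => fderiv ℝ (Function.uncurry w) z (0, 1) :=
  funext fun z => (hasDerivAt_snd_fderiv hw z.1 z.2).deriv

lemma contDiff_pt (hw : ContDiff ℝ ∞ (Function.uncurry w)) :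
    ContDiff ℝ ∞ (Function.uncurry (pt w)) := by
  rw [uncurry_pt_eq_fderiv hw]
  exact (hw.fderiv_right (by simp)).clm_apply contDiff_const

lemma contDiff_px (hw : ContDiff ℝ ∞ (Function.uncurry w)) :
    ContDiff ℝ ∞ (Function.uncurry (px w)) := by
  rw [uncurry_px_eq_fderiv hw]
  exact (hw.fderiv_right (by simp)).clm_apply contDiff_const

lemma hasDerivAt_pt (hw : ContDiff ℝ ∞ (Function.uncurry w)) (t x : ℝ) :
    HasDerivAt (fun s => w s x) (pt w t x) t :=
  (hasDerivAt_fst_fderiv hw t x).differentiableAt.hasDerivAt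

lemma hasDerivAt_px (hw : ContDiff ℝ ∞ (Function.uncurry w)) (t x : ℝ) :
    HasDerivAt (fun y => w t y) (px w t x) x :=
  (hasDerivAt_snd_fderiv hw t x).differentiableAt.hasDerivAt

lemma continuous_slice (hw : ContDiff ℝ ∞ (Function.uncurry w)) (t : ℝ) :
    Continuous (fun x => w t x) :=
  hw.continuous.comp (by fun_prop : Continuous fun x : ℝ => (t, x))

lemma pt_px_eq_px_pt (hw : ContDiff ℝ ∞ (Function.uncurry w)) : pt (px w) = px (pt w) := by
  funext t x
  have hd : DifferentiableAt ℝ (fderiv ℝ (Function.uncurry w)) (t, x) :=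
    (hw.fderiv_right (m := ∞) (by simp)).differentiable (by simp) (t, x)
  have hsymm : IsSymmSndFDerivAt ℝ (Function.uncurry w) (t, x) :=
    hw.contDiffAt.isSymmSndFDerivAt (by
      rw [minSmoothness_of_isRCLikeNormedField]
      exact WithTop.coe_le_coe.2 (le_top (a := (2 : ℕ∞))))
  have h1 := (hasDerivAt_fst_fderiv (contDiff_px hw) t x).deriv
  have h2 := (hasDerivAt_snd_fderiv (contDiff_pt hw) t x).deriv
  rw [uncurry_px_eq_fderiv hw, fderiv_clm_apply hd (by fun_prop)] at h1
  rw [uncurry_pt_eq_fderiv hw, fderiv_clm_apply hd (by fun_prop)] at h2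
  have h3 := hsymm (1, 0) (0, 1)
  simp at h1 h2
  exact h1.trans (h3.trans h2.symm)

/-- A function vanishing on a nondegenerate interval has vanishing derivative there. -/
lemma HasDerivAt.eq_zero_of_eqOn_Icc {f : ℝ → ℝ} {f' T t : ℝ} (hT : 0 < T)
    (hf : HasDerivAt f f' t) (ht : t ∈ Icc 0 T) (h0 : ∀ s ∈ Icc 0 T, f s = 0) : f' = 0 :=
  ((uniqueDiffOn_Icc hT) t ht).eq_deriv _ hf.hasDerivWithinAt
    ((hasDerivWithinAt_const t (Icc 0 T) (0 : ℝ)).congr h0 (h0 t ht))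

/-- Differentiation of `∫ w(t,x)² dx` in time. -/
lemma hasDerivAt_sqInt (hw : ContDiff ℝ ∞ (Function.uncurry w)) (a b t : ℝ) :
    HasDerivAt (fun s => sqInt a b (fun x => w s x))
      (2 * ∫ x in a..b, w t x * pt w t x) t := by
  have hcw : Continuous (Function.uncurry w) := hw.continuous
  have hcp : Continuous (Function.uncurry (pt w)) := (contDiff_pt hw).continuous
  have hcont : Continuous (fun z : ℝ × ℝ => 2 * (w z.1 z.2 * pt w z.1 z.2)) :=
    continuous_const.mul (hcw.mul hcp)
  obtain ⟨B, hB⟩ := ((isCompact_closedBall t 1).prod (isCompact_uIcc (a := a) (b := b))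
    ).exists_bound_of_continuousOn hcont.continuousOn
  have key := (intervalIntegral.hasDerivAt_integral_of_dominated_loc_of_deriv_le
    (μ := volume) (a := a) (b := b) (bound := fun _ => B)
    (F := fun s x => w s x ^ 2) (F' := fun s x => 2 * (w s x * pt w s x)) (x₀ := t)
    (Metric.closedBall_mem_nhds t one_pos)
    (Filter.Eventually.of_forall fun s =>
      ((continuous_slice hw s).pow 2).aestronglyMeasurable)
    (((continuous_slice hw t).pow 2).intervalIntegrable _ _)
    (continuous_const.mul ((continuous_slice hw t).mul
      (continuous_slice (contDiff_pt hw) t))).aestronglyMeasurable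
    (Filter.Eventually.of_forall fun x hx s hs => hB (s, x) ⟨hs, uIoc_subset_uIcc hx⟩)
    (by simp)
    (Filter.Eventually.of_forall fun x _ s _ => by
      have := (hasDerivAt_pt hw s x).pow 2
      simp only [Nat.cast_ofNat, Nat.add_one_sub_one, pow_one, mul_assoc] at this
      exact this)).2
  rw [← intervalIntegral.integral_const_mul]
  exact key

end PartialDerivatives

section SpatialEstimates

variable {a b : ℝ}

lemma sqInt_nonneg (hab : a < b) (f : ℝ → ℝ) : 0 ≤ sqInt a b f :=
  intervalIntegral.integral_nonneg hab.le fun x _ => sq_nonneg (f x)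

/-- Integrated form of a pointwise bound by a combination of two squares. -/
lemma integral_le_mul_sqInt_add {F f g : ℝ → ℝ} (α β : ℝ) (hab : a < b) (hF : Continuous F)
    (hf : Continuous f) (hg : Continuous g)
    (h : ∀ x ∈ Icc a b, F x ≤ α * f x ^ 2 + β * g x ^ 2) :
    ∫ x in a..b, F x ≤ α * sqInt a b f + β * sqInt a b g := by
  have hf2 : Continuous fun x => α * f x ^ 2 := by fun_prop
  have hg2 : Continuous fun x => β * g x ^ 2 := by fun_prop
  calc ∫ x in a..b, F x ≤ ∫ x in a..b, (α * f x ^ 2 + β * g x ^ 2) :=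
        intervalIntegral.integral_mono_on hab.le (hF.intervalIntegrable _ _)
          ((hf2.add hg2).intervalIntegrable _ _) h
    _ = α * sqInt a b f + β * sqInt a b g := by
        rw [intervalIntegral.integral_add (hf2.intervalIntegrable _ _)
          (hg2.intervalIntegrable _ _), intervalIntegral.integral_const_mul,
          intervalIntegral.integral_const_mul]
        rfl

/-- One-dimensional Sobolev embedding `H¹(a,b) ⊂ L∞(a,b)`. -/
lemma sq_le_sqInt_add_sqInt_deriv {f f' : ℝ → ℝ} (hab : a < b)
    (hf : ∀ x, HasDerivAt f (f' x) x) (hf' : Continuous f') {x : ℝ} (hx : x ∈ Icc a b) :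
    f x ^ 2 ≤ (1 + 1 / (b - a)) * (sqInt a b f + sqInt a b f') := by
  have hfc : Continuous f := continuous_iff_continuousAt.2 fun y => (hf y).continuousAt
  set S := sqInt a b f + sqInt a b f' with hS
  have hint : Continuous fun z => |2 * f z * f' z| := by fun_prop
  have habs : ∫ z in a..b, |2 * f z * f' z| ≤ S := by
    have := integral_le_mul_sqInt_add (F := fun z => |2 * f z * f' z|) 1 1 hab hint hfc hf'
      (fun z _ => by
        rw [abs_le]
        constructor <;> nlinarith [sq_nonneg (f z - f' z), sq_nonneg (f z + f' z)])
    linarith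
  have hdiff : ∀ y ∈ Icc a b, f x ^ 2 - S ≤ f y ^ 2 := by
    intro y hy
    have hftc : ∫ z in y..x, 2 * f z * f' z = f x ^ 2 - f y ^ 2 :=
      intervalIntegral.integral_eq_sub_of_hasDerivAt
        (fun z _ => by simpa using (hf z).pow 2)
        ((by fun_prop : Continuous fun z => 2 * f z * f' z).intervalIntegrable _ _)
    have h1 : |∫ z in y..x, 2 * f z * f' z| ≤ |(∫ z in y..x, |2 * f z * f' z|)| := by
      simpa using intervalIntegral.norm_integral_le_abs_integral_norm
        (f := fun z => 2 * f z * f' z) (a := y) (b := x) (μ := volume)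
    have h2 : |(∫ z in y..x, |2 * f z * f' z|)| ≤ |(∫ z in a..b, |2 * f z * f' z|)| := by
      apply intervalIntegral.abs_integral_mono_interval
      · rw [uIoc_of_le hab.le]
        intro z hz
        rw [mem_uIoc] at hz
        rcases hz with hz | hz
        · exact ⟨hy.1.trans_lt hz.1, hz.2.trans hx.2⟩
        · exact ⟨hx.1.trans_lt hz.1, hz.2.trans hy.2⟩
      · exact Filter.Eventually.of_forall fun z => abs_nonneg _
      · exact hint.intervalIntegrable _ _
    rw [abs_of_nonneg (intervalIntegral.integral_nonneg hab.le fun z _ => abs_nonneg _)] at h2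
    rw [hftc] at h1
    linarith [le_abs_self (f x ^ 2 - f y ^ 2)]
  have havg : (b - a) * (f x ^ 2 - S) ≤ sqInt a b f := by
    have := intervalIntegral.integral_mono_on hab.le
      (intervalIntegrable_const (μ := volume))
      ((hfc.pow 2).intervalIntegrable a b) hdiff
    rwa [intervalIntegral.integral_const, smul_eq_mul] at this
  have hba : 0 < b - a := sub_pos.2 hab
  have hle : sqInt a b f ≤ S := by
    have := sqInt_nonneg hab f'
    linarith
  have : f x ^ 2 - S ≤ S / (b - a) := by
    rw [le_div_iff₀ hba]
    linarith
  calc f x ^ 2 ≤ S + S / (b - a) := by linarith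
    _ = _ := by ring

/-- Integration by parts when the first factor vanishes at both ends. -/
lemma integral_mul_deriv_of_boundary_zero {f f' g g' : ℝ → ℝ}
    (hf : ∀ x, HasDerivAt f (f' x) x) (hg : ∀ x, HasDerivAt g (g' x) x)
    (hf' : Continuous f') (hg' : Continuous g') (hfa : f a = 0) (hfb : f b = 0) :
    ∫ x in a..b, f x * g' x = -∫ x in a..b, f' x * g x := by
  rw [intervalIntegral.integral_mul_deriv_eq_deriv_mul (fun x _ => hf x) (fun x _ => hg x)
    (hf'.intervalIntegrable _ _) (hg'.intervalIntegrable _ _), hfa, hfb]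
  ring

/-- Elliptic bound for the temperature gradient at a fixed time: `τ`, `τx`, `τxx` play the roles
of `θ`, `θ_x`, `θ_xx`, and `h`, `V` those of `θ_t`, `u_tx`. -/
lemma sqInt_gradient_le {τ τx τxx h V : ℝ → ℝ} {μ M : ℝ} (hab : a < b) (hM : 0 < M)
    (hτ : ∀ x, HasDerivAt τ (τx x) x) (hτx : ∀ x, HasDerivAt τx (τxx x) x)
    (hτxx : Continuous τxx) (hh : Continuous h) (hV : Continuous V)
    (heq : ∀ x ∈ Icc a b, h x - τxx x + μ * τ x * V x = 0)
    (ha : τx a = 0) (hb : τx b = 0)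
    (hτM : sqInt a b τ ≤ M) (hhM : sqInt a b h ≤ M) (hVM : sqInt a b V ≤ M) :
    sqInt a b τx ≤ 3 * M + μ ^ 2 * (1 + 1 / (b - a)) * M ^ 2 := by
  have hτc : Continuous τ := continuous_iff_continuousAt.2 fun y => (hτ y).continuousAt
  have hτxc : Continuous τx := continuous_iff_continuousAt.2 fun y => (hτx y).continuousAt
  set k := 1 + 1 / (b - a) with hk
  have hkpos : 0 < k := by
    have := sub_pos.2 hab
    positivity
  set S := k * (sqInt a b τ + sqInt a b τx) with hS
  have hsup : ∀ x ∈ Icc a b, τ x ^ 2 ≤ S := fun x hx =>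
    sq_le_sqInt_add_sqInt_deriv hab hτ hτxc hx
  have hgrad : sqInt a b τx = -∫ x in a..b, τ x * τxx x := by
    rw [← neg_eq_iff_eq_neg]
    have := integral_mul_deriv_of_boundary_zero hτx hτ hτxx hτxc ha hb
    simp only [sqInt, sq, this, neg_neg, mul_comm]
  have hsplit : -∫ x in a..b, τ x * τxx x
      = (∫ x in a..b, -(τ x * h x)) + ∫ x in a..b, -(μ * τ x ^ 2 * V x) := by
    rw [← intervalIntegral.integral_neg, ← intervalIntegral.integral_add]
    · refine intervalIntegral.integral_congr fun x hx => ?_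
      rw [uIcc_of_le hab.le] at hx
      linear_combination τ x * heq x hx
    · exact (by fun_prop : Continuous _).intervalIntegrable _ _
    · exact (by fun_prop : Continuous _).intervalIntegrable _ _
  have h1 := integral_le_mul_sqInt_add (F := fun x => -(τ x * h x)) (1 / 2) (1 / 2) hab
    (by fun_prop) hτc hh (fun x _ => by nlinarith [sq_nonneg (τ x + h x)])
  have h2 := integral_le_mul_sqInt_add (F := fun x => -(μ * τ x ^ 2 * V x))
    (k * M * μ ^ 2 / 2) (S / (2 * k * M)) hab
    (by fun_prop) hτc hV (fun x hx => by
      have hVS : τ x ^ 2 * V x ^ 2 / (2 * k * M) ≤ S * V x ^ 2 / (2 * k * M) := by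
        gcongr
        exact hsup x hx
      have hyoung : -(μ * τ x ^ 2 * V x)
          ≤ k * M * μ ^ 2 / 2 * τ x ^ 2 + τ x ^ 2 * V x ^ 2 / (2 * k * M) := by
        have : 0 ≤ τ x ^ 2 * (k * M * μ + V x) ^ 2 / (2 * k * M) := by positivity
        have e : τ x ^ 2 * (k * M * μ + V x) ^ 2 / (2 * k * M)
          = k * M * μ ^ 2 / 2 * τ x ^ 2 + τ x ^ 2 * V x ^ 2 / (2 * k * M)
            + μ * τ x ^ 2 * V x := by
          field_simp
          ring
        linarith
      calc _ ≤ _ := hyoung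
        _ ≤ _ := by rw [div_mul_eq_mul_div S]; linarith)
  have h3 : S / (2 * k * M) * sqInt a b V ≤ (sqInt a b τ + sqInt a b τx) / 2 := by
    have := sqInt_nonneg hab τ
    have := sqInt_nonneg hab τx
    calc S / (2 * k * M) * sqInt a b V ≤ S / (2 * k * M) * M := by gcongr
      _ = _ := by rw [hS]; field_simp
  have h4 : k * M * μ ^ 2 / 2 * sqInt a b τ ≤ k * M * μ ^ 2 / 2 * M := by gcongr
  nlinarith

/-- Energy inequality at a fixed time. The functions `W`, `Z`, `Zx`, `V`, `Vx` play the roles of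
`u_tt`, `u_ttx`, `u_ttxx`, `u_tx`, `u_txx`, while `τ`, `τx`, `h`, `H`, `Hx` stand for
`θ`, `θ_x`, `θ_t`, `θ_tx`, `θ_txx`, and `Wt`, `ht` for `u_ttt`, `θ_tt`. -/
lemma second_order_energy_le {W Z Zx V Vx τ τx h H Hx Wt ht : ℝ → ℝ} {μ ν M G : ℝ}
    (hab : a < b) (hν : 0 ≤ ν) (hM : 0 < M) (hG : 0 < G)
    (hW : ∀ x, HasDerivAt W (Z x) x) (hZ : ∀ x, HasDerivAt Z (Zx x) x) (hZx : Continuous Zx)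
    (hV : ∀ x, HasDerivAt V (Vx x) x) (hVx : Continuous Vx)
    (hτ : ∀ x, HasDerivAt τ (τx x) x) (hτx : Continuous τx)
    (hh : ∀ x, HasDerivAt h (H x) x) (hH : ∀ x, HasDerivAt H (Hx x) x) (hHx : Continuous Hx)
    (hWt : ∀ x ∈ Icc a b, Wt x = Vx x + ν * Zx x - μ * H x)
    (hht : ∀ x ∈ Icc a b, ht x = Hx x - μ * h x * V x - μ * τ x * Z x)
    (hWa : W a = 0) (hWb : W b = 0) (hHa : H a = 0) (hHb : H b = 0)
    (hτM : sqInt a b τ ≤ M) (hVM : sqInt a b V ≤ M) (hτG : sqInt a b τx ≤ G) :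
    2 * (∫ x in a..b, W x * Wt x) + 2 * (∫ x in a..b, V x * Z x)
      + 2 * (∫ x in a..b, h x * ht x) + sqInt a b H
      ≤ (4 * μ ^ 2 + 1 / 2 + 8 * (1 + 1 / (b - a)) * μ ^ 2 * (M + G))
        * (sqInt a b W + sqInt a b V + sqInt a b h) := by
  have hWc : Continuous W := continuous_iff_continuousAt.2 fun y => (hW y).continuousAt
  have hZc : Continuous Z := continuous_iff_continuousAt.2 fun y => (hZ y).continuousAt
  have hVc : Continuous V := continuous_iff_continuousAt.2 fun y => (hV y).continuousAt
  have hτc : Continuous τ := continuous_iff_continuousAt.2 fun y => (hτ y).continuousAt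
  have hhc : Continuous h := continuous_iff_continuousAt.2 fun y => (hh y).continuousAt
  have hHc : Continuous H := continuous_iff_continuousAt.2 fun y => (hH y).continuousAt
  have ii : ∀ {f : ℝ → ℝ}, Continuous f → IntervalIntegrable f volume a b :=
    fun hf => hf.intervalIntegrable _ _
  set k := 1 + 1 / (b - a) with hk
  have hkpos : 0 < k := by
    have := sub_pos.2 hab
    positivity
  set p := sqInt a b W with hp
  set q := sqInt a b V with hq
  set r := sqInt a b h with hr
  set d := sqInt a b H with hd
  have hp0 : 0 ≤ p := sqInt_nonneg hab W
  have hq0 : 0 ≤ q := sqInt_nonneg hab V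
  have hr0 : 0 ≤ r := sqInt_nonneg hab h
  have hd0 : 0 ≤ d := sqInt_nonneg hab H
  have hsuph : ∀ x ∈ Icc a b, h x ^ 2 ≤ k * (r + d) := fun x hx =>
    sq_le_sqInt_add_sqInt_deriv hab hh hHc hx
  have hsupτ : ∀ x ∈ Icc a b, τ x ^ 2 ≤ k * (M + G) := fun x hx =>
    (sq_le_sqInt_add_sqInt_deriv hab hτ hτx hx).trans (by gcongr)
  -- The mechanical part.
  have hmech : ∫ x in a..b, W x * Wt x
      = -(∫ x in a..b, V x * Z x) - ν * sqInt a b Z + ∫ x in a..b, -(μ * H x * W x) := by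
    have hWV := integral_mul_deriv_of_boundary_zero hW hV hZc hVx hWa hWb
    have hWZ := integral_mul_deriv_of_boundary_zero hW hZ hZc hZx hWa hWb
    have hsplit : ∫ x in a..b, W x * Wt x = (∫ x in a..b, W x * Vx x)
        + ν * (∫ x in a..b, W x * Zx x) + ∫ x in a..b, -(μ * H x * W x) := by
      rw [← intervalIntegral.integral_const_mul, ← intervalIntegral.integral_add
        (ii (by fun_prop)) (ii (by fun_prop)), ← intervalIntegral.integral_add
        (ii (by fun_prop)) (ii (by fun_prop))]
      refine intervalIntegral.integral_congr fun x hx => ?_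
      rw [uIcc_of_le hab.le] at hx
      simp only [hWt x hx]
      ring
    rw [hsplit, hWV, hWZ]
    simp only [sqInt, sq, mul_comm (V _)]
    ring
  -- The thermal part.
  have hther : ∫ x in a..b, h x * ht x = -d + (∫ x in a..b, -(μ * h x ^ 2 * V x))
      + (∫ x in a..b, μ * τx x * h x * W x) + ∫ x in a..b, μ * τ x * H x * W x := by
    have hHh := integral_mul_deriv_of_boundary_zero hH hh hHx hHc hHa hHb
    have hWhτ := integral_mul_deriv_of_boundary_zero hW (fun x => (hh x).mul (hτ x)) hZc
      (by fun_prop) hWa hWb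
    have hsplit : ∫ x in a..b, h x * ht x = (∫ x in a..b, Hx x * h x)
        + (∫ x in a..b, -(μ * h x ^ 2 * V x)) - μ * ∫ x in a..b, Z x * (h * τ) x := by
      rw [← intervalIntegral.integral_const_mul, ← intervalIntegral.integral_add
        (ii (by fun_prop)) (ii (by fun_prop)), ← intervalIntegral.integral_sub
        (ii (by fun_prop)) (ii (by fun_prop))]
      refine intervalIntegral.integral_congr fun x hx => ?_
      rw [uIcc_of_le hab.le] at hx
      simp only [hht x hx, Pi.mul_apply]
      ring
    have hsplit' : μ * (∫ x in a..b, W x * (H x * τ x + h x * τx x))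
        = (∫ x in a..b, μ * τx x * h x * W x) + ∫ x in a..b, μ * τ x * H x * W x := by
      rw [← intervalIntegral.integral_const_mul, ← intervalIntegral.integral_add
        (ii (by fun_prop)) (ii (by fun_prop))]
      exact intervalIntegral.integral_congr fun x _ => by ring
    have hdd : d = ∫ x in a..b, H x * H x := by simp only [hd, sqInt, sq]
    rw [← hdd] at hHh
    rw [hsplit]
    linear_combination hsplit' + hHh - μ * hWhτ
  have e1 := integral_le_mul_sqInt_add (F := fun x => -(μ * H x * W x)) (1 / 8) (2 * μ ^ 2) hab
    (by fun_prop) hHc hWc (fun x _ => by nlinarith [sq_nonneg (H x + 4 * μ * W x)])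
  have e2 := integral_le_mul_sqInt_add (F := fun x => -(μ * h x ^ 2 * V x))
    (2 * k * M * μ ^ 2) (k * (r + d) / (8 * k * M)) hab
    (by fun_prop) hhc hVc (fun x hx => by
      have hVS : h x ^ 2 * V x ^ 2 / (8 * k * M) ≤ k * (r + d) * V x ^ 2 / (8 * k * M) := by
        gcongr
        exact hsuph x hx
      have hsq : 0 ≤ h x ^ 2 * (4 * k * M * μ + V x) ^ 2 / (8 * k * M) := by positivity
      have e : h x ^ 2 * (4 * k * M * μ + V x) ^ 2 / (8 * k * M)
          = 2 * k * M * μ ^ 2 * h x ^ 2 + h x ^ 2 * V x ^ 2 / (8 * k * M)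
            + μ * h x ^ 2 * V x := by
        field_simp
        ring
      rw [div_mul_eq_mul_div (k * (r + d))]
      linarith)
  have e2' : k * (r + d) / (8 * k * M) * q ≤ (r + d) / 8 := by
    calc k * (r + d) / (8 * k * M) * q ≤ k * (r + d) / (8 * k * M) * M := by gcongr
      _ = _ := by field_simp
  have e3 := integral_le_mul_sqInt_add (F := fun x => μ * τx x * h x * W x)
    (k * (r + d) / (8 * k * G)) (2 * k * G * μ ^ 2) hab
    (by fun_prop) hτx hWc (fun x hx => by
      have hVS : h x ^ 2 * τx x ^ 2 / (8 * k * G) ≤ k * (r + d) * τx x ^ 2 / (8 * k * G) := by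
        gcongr
        exact hsuph x hx
      have hsq : 0 ≤ (4 * k * G * μ * W x - h x * τx x) ^ 2 / (8 * k * G) := by positivity
      have e : (4 * k * G * μ * W x - h x * τx x) ^ 2 / (8 * k * G)
          = 2 * k * G * μ ^ 2 * W x ^ 2 + h x ^ 2 * τx x ^ 2 / (8 * k * G)
            - μ * τx x * h x * W x := by
        field_simp
        ring
      rw [div_mul_eq_mul_div (k * (r + d))]
      linarith)
  have e3' : k * (r + d) / (8 * k * G) * sqInt a b τx ≤ (r + d) / 8 := by
    calc k * (r + d) / (8 * k * G) * sqInt a b τx ≤ k * (r + d) / (8 * k * G) * G := by gcongr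
      _ = _ := by field_simp
  have e4 := integral_le_mul_sqInt_add (F := fun x => μ * τ x * H x * W x)
    (1 / 8) (2 * μ ^ 2 * (k * (M + G))) hab
    (by fun_prop) hHc hWc (fun x hx => by
      have hWS : 2 * μ ^ 2 * τ x ^ 2 * W x ^ 2 ≤ 2 * μ ^ 2 * (k * (M + G)) * W x ^ 2 := by
        gcongr
        exact hsupτ x hx
      nlinarith [sq_nonneg (H x - 4 * μ * τ x * W x)])
  have hvisc : 0 ≤ ν * sqInt a b Z := mul_nonneg hν (sqInt_nonneg hab Z)
  have hq1 : 0 ≤ μ ^ 2 * q := by positivity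
  have hr1 : 0 ≤ μ ^ 2 * r := by positivity
  have hkMp : 0 ≤ k * M * μ ^ 2 * p := by positivity
  have hkMq : 0 ≤ k * M * μ ^ 2 * q := by positivity
  have hkMr : 0 ≤ k * M * μ ^ 2 * r := by positivity
  have hkGq : 0 ≤ k * G * μ ^ 2 * q := by positivity
  have hkGr : 0 ≤ k * G * μ ^ 2 * r := by positivity
  rw [hmech, hther]
  linarith

end SpatialEstimates

section Gronwall

variable {f f' : ℝ → ℝ} {τ : ℝ}

/-- Linear Gronwall inequality. -/
lemma le_mul_exp_of_deriv_le_mul {K : ℝ} (hτ : 0 ≤ τ) (hf : ∀ t, HasDerivAt f (f' t) t)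
    (h : ∀ t ∈ Icc 0 τ, f' t ≤ K * f t) : f τ ≤ f 0 * Real.exp (K * τ) := by
  have := le_gronwallBound_of_liminf_deriv_right_le (f := f) (f' := f') (δ := f 0) (K := K)
    (ε := 0) (a := 0) (b := τ) (fun t _ => (hf t).continuousAt.continuousWithinAt)
    (fun t _ r hr => (hf t).hasDerivWithinAt.liminf_right_slope_le hr) le_rfl
    (fun t ht => by simpa using h t ⟨ht.1, ht.2.le⟩) τ ⟨hτ, le_rfl⟩
  rwa [gronwallBound_ε0, sub_zero] at this

/-- Continuation principle: if `f' ≤ L f` as long as `f ≤ 2m`, and `f 0 ≤ m`, then `f ≤ 2m` for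
a short time. -/
lemma le_two_mul_of_deriv_le_mul {m L : ℝ} (hm : 0 < m) (hL : 0 ≤ L)
    (hτ : Real.exp ((L + 1) * τ) ≤ 2) (hf : ∀ t, HasDerivAt f (f' t) t) (h0 : f 0 ≤ m)
    (h : ∀ t ∈ Icc 0 τ, f t ≤ 2 * m → f' t ≤ L * f t) : ∀ t ∈ Icc 0 τ, f t ≤ 2 * m := by
  have hB : ∀ t ∈ Icc 0 τ, m * Real.exp ((L + 1) * t) ≤ 2 * m := by
    intro t ht
    have : Real.exp ((L + 1) * t) ≤ 2 :=
      (Real.exp_le_exp.2 (mul_le_mul_of_nonneg_left ht.2 (by linarith))).trans hτ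
    nlinarith
  have hBd : ∀ t, HasDerivAt (fun t => m * Real.exp ((L + 1) * t))
      ((L + 1) * (m * Real.exp ((L + 1) * t))) t := by
    intro t
    exact ((((hasDerivAt_id t).const_mul (L + 1)).exp).const_mul m).congr_deriv
      (by simp only [id]; ring)
  intro t ht
  refine le_trans ?_ (hB t ht)
  refine image_le_of_deriv_right_lt_deriv_boundary
    (fun s _ => (hf s).continuousAt.continuousWithinAt)
    (fun s _ => (hf s).hasDerivWithinAt) (by simpa using h0) hBd ?_ ht
  intro s hs hfs
  have hs' : s ∈ Icc 0 τ := ⟨hs.1, hs.2.le⟩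
  have h1 := h s hs' (hfs.trans_le (hB s hs'))
  have h2 : 0 < m * Real.exp ((L + 1) * s) := by positivity
  rw [hfs] at h1
  linarith

end Gronwall

section Energy

variable {a b μ T ν : ℝ} {u θ : ℝ → ℝ → ℝ}

/-- The second-order energy `‖u_tt‖² + ‖u_tx‖² + ‖θ_t‖²`. -/
noncomputable def secondOrderEnergy (a b : ℝ) (u θ : ℝ → ℝ → ℝ) (t : ℝ) : ℝ :=
  sqInt a b (fun x => pt (pt u) t x) + sqInt a b (fun x => px (pt u) t x)
    + sqInt a b (fun x => pt θ t x)

/-- The time derivative of `secondOrderEnergy`. -/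
noncomputable def secondOrderEnergyDeriv (a b : ℝ) (u θ : ℝ → ℝ → ℝ) (t : ℝ) : ℝ :=
  2 * (∫ x in a..b, pt (pt u) t x * pt (pt (pt u)) t x)
    + 2 * (∫ x in a..b, px (pt u) t x * px (pt (pt u)) t x)
    + 2 * (∫ x in a..b, pt θ t x * pt (pt θ) t x)

/-- Growth rate of the second-order energy as long as it is bounded by `M`. -/
noncomputable def energyRate (a b μ M : ℝ) : ℝ :=
  4 * μ ^ 2 + 1 / 2 + 8 * (1 + 1 / (b - a)) * μ ^ 2
    * (M + (3 * M + μ ^ 2 * (1 + 1 / (b - a)) * M ^ 2))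

lemma hasDerivAt_secondOrderEnergy (hu : ContDiff ℝ ∞ (Function.uncurry u))
    (hθ : ContDiff ℝ ∞ (Function.uncurry θ)) (a b t : ℝ) :
    HasDerivAt (secondOrderEnergy a b u θ) (secondOrderEnergyDeriv a b u θ t) t := by
  have hV := hasDerivAt_sqInt (contDiff_px (contDiff_pt hu)) a b t
  rw [pt_px_eq_px_pt (contDiff_pt hu)] at hV
  exact ((hasDerivAt_sqInt (contDiff_pt (contDiff_pt hu)) a b t).add hV).add
    (hasDerivAt_sqInt (contDiff_pt hθ) a b t)

/-- The momentum equation differentiated in time. -/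
lemma IsRegSolution.momentum_deriv (hsol : IsRegSolution a b μ T ν u θ) (hT : 0 < T) {t x : ℝ}
    (ht : t ∈ Icc 0 T) (hx : x ∈ Icc a b) :
    pt (pt (pt u)) t x
      = px (px (pt u)) t x + ν * px (px (pt (pt u))) t x - μ * px (pt θ) t x := by
  obtain ⟨hu, hθ, hmom, -, -, -⟩ := hsol
  have hut := contDiff_pt hu
  have hder := ((((hasDerivAt_pt (contDiff_pt hut) t x).sub
    (hasDerivAt_pt (contDiff_px (contDiff_px hu)) t x)).sub
    ((hasDerivAt_pt (contDiff_px (contDiff_px hut)) t x).const_mul ν)).add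
    ((hasDerivAt_pt (contDiff_px hθ) t x).const_mul μ)).eq_zero_of_eqOn_Icc hT ht
    (fun s hs => by
      have := hmom s hs x hx
      simp only [Pi.add_apply, Pi.sub_apply]
      linarith)
  rw [pt_px_eq_px_pt (contDiff_px hu), pt_px_eq_px_pt hu, pt_px_eq_px_pt (contDiff_px hut),
    pt_px_eq_px_pt hut, pt_px_eq_px_pt hθ] at hder
  linarith

/-- The heat equation differentiated in time. -/
lemma IsRegSolution.heat_deriv (hsol : IsRegSolution a b μ T ν u θ) (hT : 0 < T) {t x : ℝ}
    (ht : t ∈ Icc 0 T) (hx : x ∈ Icc a b) :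
    pt (pt θ) t x = px (px (pt θ)) t x - μ * pt θ t x * px (pt u) t x
      - μ * θ t x * px (pt (pt u)) t x := by
  obtain ⟨hu, hθ, -, hheat, -, -⟩ := hsol
  have hut := contDiff_pt hu
  have hder := (((hasDerivAt_pt (contDiff_pt hθ) t x).sub
    (hasDerivAt_pt (contDiff_px (contDiff_px hθ)) t x)).add
    (((hasDerivAt_pt hθ t x).const_mul μ).mul
      (hasDerivAt_pt (contDiff_px hut) t x))).eq_zero_of_eqOn_Icc hT ht (hheat · · x hx)
  rw [pt_px_eq_px_pt (contDiff_px hθ), pt_px_eq_px_pt hθ, pt_px_eq_px_pt hut] at hder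
  linarith

/-- Differential inequality for the second-order energy, uniform in `ν`. -/
lemma secondOrderEnergyDeriv_add_le {M t : ℝ} (hab : a < b) (hT : 0 < T) (hν : 0 ≤ ν)
    (hM : 0 < M) (hsol : IsRegSolution a b μ T ν u θ) (ht : t ∈ Icc 0 T)
    (hle : secondOrderEnergy a b u θ t + sqInt a b (fun x => θ t x) ≤ M) :
    secondOrderEnergyDeriv a b u θ t + sqInt a b (fun x => px (pt θ) t x)
      ≤ energyRate a b μ M * secondOrderEnergy a b u θ t := by
  have hmom := fun x hx => hsol.momentum_deriv hT ht (x := x) hx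
  have hheat' := fun x hx => hsol.heat_deriv hT ht (x := x) hx
  obtain ⟨hu, hθ, -, hheat, hbu, hbθ⟩ := hsol
  have hut := contDiff_pt hu
  have hutt := contDiff_pt hut
  have hθt := contDiff_pt hθ
  have hut0 : ∀ s ∈ Icc 0 T, pt u s a = 0 ∧ pt u s b = 0 := fun s hs =>
    ⟨(hasDerivAt_pt hu s a).eq_zero_of_eqOn_Icc hT hs fun r hr => (hbu r hr).1,
      (hasDerivAt_pt hu s b).eq_zero_of_eqOn_Icc hT hs fun r hr => (hbu r hr).2⟩
  have hWa := (hasDerivAt_pt hut t a).eq_zero_of_eqOn_Icc hT ht fun r hr => (hut0 r hr).1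
  have hWb := (hasDerivAt_pt hut t b).eq_zero_of_eqOn_Icc hT ht fun r hr => (hut0 r hr).2
  have hHa := (hasDerivAt_pt (contDiff_px hθ) t a).eq_zero_of_eqOn_Icc hT ht
    fun r hr => (hbθ r hr).1
  have hHb := (hasDerivAt_pt (contDiff_px hθ) t b).eq_zero_of_eqOn_Icc hT ht
    fun r hr => (hbθ r hr).2
  rw [pt_px_eq_px_pt hθ] at hHa hHb
  have hp := sqInt_nonneg hab (fun x => pt (pt u) t x)
  have hq := sqInt_nonneg hab (fun x => px (pt u) t x)
  have hr := sqInt_nonneg hab (fun x => pt θ t x)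
  have hn := sqInt_nonneg hab (fun x => θ t x)
  unfold secondOrderEnergy at hle ⊢
  have hgrad := sqInt_gradient_le (μ := μ) hab hM (hasDerivAt_px hθ t)
    (hasDerivAt_px (contDiff_px hθ) t) (continuous_slice (contDiff_px (contDiff_px hθ)) t)
    (continuous_slice hθt t) (continuous_slice (contDiff_px hut) t) (hheat t ht)
    (hbθ t ht).1 (hbθ t ht).2 (by linarith) (by linarith) (by linarith)
  have hba : 0 < b - a := sub_pos.2 hab
  exact second_order_energy_le hab hν hM (by positivity)
    (hasDerivAt_px hutt t) (hasDerivAt_px (contDiff_px hutt) t)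
    (continuous_slice (contDiff_px (contDiff_px hutt)) t)
    (hasDerivAt_px (contDiff_px hut) t) (continuous_slice (contDiff_px (contDiff_px hut)) t)
    (hasDerivAt_px hθ t) (continuous_slice (contDiff_px hθ) t)
    (hasDerivAt_px hθt t) (hasDerivAt_px (contDiff_px hθt) t)
    (continuous_slice (contDiff_px (contDiff_px hθt)) t)
    hmom hheat' hWa hWb hHa hHb (by linarith) (by linarith) hgrad

end Energy

/-- **Short-time second-order a priori estimate, uniform in the artificial viscosity.**
For all `a < b`, `μ > 0`, `R > 0` there exist `T₀ > 0` and `C > 0`, depending only on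
`a, b, μ, R`, such that for every `T > 0`, every `ν ≥ 0` and every nonnegative smooth solution
whose initial data are bounded by `R` as indicated, one has for `t ∈ [0, min T T₀]`:
`‖u_tt(t)‖² + ‖u_tx(t)‖² + ‖θ_t(t)‖² + ∫₀ᵗ ‖θ_tx‖²
  ≤ C (‖u_tt(0)‖ + ‖u_tx(0)‖ + ‖θ_t(0)‖)²`. -/
theorem short_time_second_order_estimate (a b μ R : ℝ) (hab : a < b) (hμ : 0 < μ) (hR : 0 < R) :
    ∃ T₀ > (0:ℝ), ∃ C > (0:ℝ), ∀ T > (0:ℝ), ∀ ν ≥ (0:ℝ), ∀ u θ : ℝ → ℝ → ℝ,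
      IsRegSolution a b μ T ν u θ →
      (∀ t ∈ Icc (0:ℝ) T, ∀ x ∈ Icc a b, 0 ≤ θ t x) →
      L2norm a b (fun x => pt u 0 x) ≤ R →
      L2norm a b (fun x => px u 0 x) ≤ R →
      L2norm a b (fun x => θ 0 x) ≤ R →
      (∫ x in a..b, θ 0 x) ≤ R →
      L2norm a b (fun x => pt (pt u) 0 x) ≤ R →
      L2norm a b (fun x => px (pt u) 0 x) ≤ R →
      L2norm a b (fun x => pt θ 0 x) ≤ R →
      ∀ t ∈ Icc (0:ℝ) (min T T₀),
        sqInt a b (fun x => pt (pt u) t x) + sqInt a b (fun x => px (pt u) t x)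
            + sqInt a b (fun x => pt θ t x)
            + (∫ s in (0:ℝ)..t, sqInt a b (fun x => px (pt θ) s x))
          ≤ C * (L2norm a b (fun x => pt (pt u) 0 x) + L2norm a b (fun x => px (pt u) 0 x)
            + L2norm a b (fun x => pt θ 0 x)) ^ 2 := by
  have hba : 0 < b - a := sub_pos.2 hab
  set M := 8 * R ^ 2 with hMdef
  have hM : 0 < M := by positivity
  have hK : 0 < energyRate a b μ M := by
    unfold energyRate
    positivity
  set K := energyRate a b μ M with hKdef
  refine ⟨Real.log 2 / (K + 2), by have := Real.log_pos one_lt_two; positivity, 2, two_pos, ?_⟩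
  intro T hT ν hν u θ hsol _ _ _ hθ0 _ hW0 hV0 hh0 t ht
  obtain ⟨ht0, htT⟩ := ht
  have hθs : ContDiff ℝ ∞ (Function.uncurry θ) := hsol.2.1
  set Y := secondOrderEnergy a b u θ with hY
  set Y' := secondOrderEnergyDeriv a b u θ with hY'
  have hYd : ∀ s, HasDerivAt Y (Y' s) s := hasDerivAt_secondOrderEnergy hsol.1 hθs a b
  have hnd := hasDerivAt_sqInt hθs a b
  have hY0 : ∀ s, 0 ≤ Y s := fun s =>
    add_nonneg (add_nonneg (sqInt_nonneg hab _) (sqInt_nonneg hab _)) (sqInt_nonneg hab _)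
  have htime : ∀ s ∈ Icc 0 t, s ∈ Icc 0 T := fun s hs =>
    ⟨hs.1, hs.2.trans (htT.trans (min_le_left _ _))⟩
  have hexp : Real.exp ((K + 1 + 1) * t) ≤ 2 := by
    have h1 : t * (K + 2) ≤ Real.log 2 :=
      (le_div_iff₀ (by positivity)).1 (htT.trans (min_le_right _ _))
    calc Real.exp ((K + 1 + 1) * t) ≤ Real.exp (Real.log 2) :=
          Real.exp_le_exp.2 (by linarith)
      _ = 2 := Real.exp_log two_pos
  have hsq : ∀ f : ℝ → ℝ, L2norm a b f ≤ R → sqInt a b f ≤ R ^ 2 := fun f hf =>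
    (Real.sqrt_le_left hR.le).1 hf
  -- Continuation: the energy together with `‖θ‖²` stays below `M`.
  have hbound : ∀ s ∈ Icc 0 t, Y s + sqInt a b (fun x => θ s x) ≤ M := by
    have hcont := le_two_mul_of_deriv_le_mul (f := fun s => Y s + sqInt a b (fun x => θ s x))
      (f' := fun s => Y' s + 2 * ∫ x in a..b, θ s x * pt θ s x) (m := 4 * R ^ 2) (L := K + 1)
      (τ := t) (by positivity) (by positivity) hexp (fun s => (hYd s).add (hnd s)) ?_ ?_
    · intro s hs
      linarith [hcont s hs]
    · have h1 := hsq _ hW0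
      have h2 := hsq _ hV0
      have h3 := hsq _ hh0
      have h4 := hsq _ hθ0
      simp only [hY, secondOrderEnergy]
      linarith
    · intro s hs hsM
      have hn0 := sqInt_nonneg hab (fun x => θ s x)
      have h1 := secondOrderEnergyDeriv_add_le hab hT hν hM hsol (htime s hs)
        (hsM.trans_eq (by ring))
      have h2 := integral_le_mul_sqInt_add (F := fun x => θ s x * pt θ s x) (1 / 2) (1 / 2) hab
        ((continuous_slice hθs s).mul (continuous_slice (contDiff_pt hθs) s))
        (continuous_slice hθs s) (continuous_slice (contDiff_pt hθs) s)
        (fun x _ => by nlinarith [sq_nonneg (θ s x - pt θ s x)])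
      have h3 : sqInt a b (fun x => pt θ s x) ≤ Y s := by
        have hp := sqInt_nonneg hab (fun x => pt (pt u) s x)
        have hq := sqInt_nonneg hab (fun x => px (pt u) s x)
        simp only [hY, secondOrderEnergy]
        linarith
      have hd := sqInt_nonneg hab (fun x => px (pt θ) s x)
      have hKn : 0 ≤ K * sqInt a b (fun x => θ s x) := by positivity
      simp only [← hY, ← hY', ← hKdef] at h1 ⊢
      linarith
  -- Linear Gronwall inequality for the energy and the dissipation.
  have hDc : Continuous fun s => sqInt a b (fun x => px (pt θ) s x) :=
    continuous_iff_continuousAt.2 fun s =>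
      (hasDerivAt_sqInt (contDiff_px (contDiff_pt hθs)) a b s).continuousAt
  have hgron := le_mul_exp_of_deriv_le_mul (K := K) (τ := t)
    (f := fun s => Y s + ∫ r in (0 : ℝ)..s, sqInt a b (fun x => px (pt θ) r x))
    (f' := fun s => Y' s + sqInt a b (fun x => px (pt θ) s x)) ht0
    (fun s => (hYd s).add (intervalIntegral.integral_hasDerivAt_right
      (hDc.intervalIntegrable _ _) (hDc.stronglyMeasurableAtFilter _ _) hDc.continuousAt))
    (fun s hs => by
      have h1 := secondOrderEnergyDeriv_add_le hab hT hν hM hsol (htime s hs) (hbound s hs)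
      have h2 : 0 ≤ ∫ r in (0 : ℝ)..s, sqInt a b (fun x => px (pt θ) r x) :=
        intervalIntegral.integral_nonneg hs.1 fun r _ => sqInt_nonneg hab _
      have h3 := mul_nonneg hK.le h2
      simp only [← hY, ← hY', ← hKdef] at h1 ⊢
      linarith)
  simp only [intervalIntegral.integral_same, add_zero] at hgron
  have hexpK : Real.exp (K * t) ≤ 2 := (Real.exp_le_exp.2 (by nlinarith)).trans hexp
  calc _ ≤ Y 0 * Real.exp (K * t) := hgron
    _ ≤ Y 0 * 2 := mul_le_mul_of_nonneg_left hexpK (hY0 0)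
    _ ≤ _ := by
      have hsqrt : ∀ f : ℝ → ℝ, sqInt a b f = L2norm a b f ^ 2 := fun f =>
        (Real.sq_sqrt (sqInt_nonneg hab f)).symm
      have hnn : ∀ f : ℝ → ℝ, 0 ≤ L2norm a b f := fun f => Real.sqrt_nonneg _
      simp only [hY, secondOrderEnergy, hsqrt]
      have hA := hnn (fun x => pt (pt u) 0 x)
      have hB := hnn (fun x => px (pt u) 0 x)
      have hC := hnn (fun x => pt θ 0 x)
      nlinarith [mul_nonneg hA hB, mul_nonneg hA hC, mul_nonneg hB hC]
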